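/- For every τ ∈ ℂ with Im τ > 0 one has T(τ; 2τ) = e^{−πiτ} [ η(4τ)⁵/η(2τ)⁴ + η(4τ)^{17}/(4 η(2τ)⁸ η(8τ)⁸) − η(4τ)⁷ η(τ)⁴/(4 η(2τ)⁶ η(8τ)⁴) ], both sides being well defined (all denominators nonvanishing on the upper half-plane). -/

import Mathlib

open scoped BigOperators Classical
open Filter Topology

noncomputable section

/-- finite q-Pochhammer symbol $(x;q)_n$ -/
def qPoch (x q : ℂ) (n : ℕ) : ℂ := ∏ j ∈ Finset.range n, (1 - x * q ^ j)

/-- infinite q-Pochhammer symbol $(x;q)_\infty$ -/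
def qPochInf (x q : ℂ) : ℂ := ∏' j : ℕ, (1 - x * q ^ j)

/-- $e(x) = e^{2\pi i x}$ -/
def ee (x : ℂ) : ℂ := Complex.exp (2 * Real.pi * Complex.I * x)

/-- $\zeta_n^m = e(m/n)$ -/
def zeta (m : ℤ) (n : ℕ) : ℂ := ee ((m : ℂ) / (n : ℂ))

/-- Dedekind eta -/
def eta (τ : ℂ) : ℂ := Complex.exp (Real.pi * Complex.I * τ / 12) * qPochInf (ee τ) (ee τ)

/-- Jacobi theta -/
def theta (z τ : ℂ) : ℂ :=
  -Complex.I * Complex.exp (Real.pi * Complex.I * τ / 4) * Complex.exp (-(Real.pi * Complex.I * z))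
    * qPochInf (ee τ) (ee τ) * qPochInf (ee z) (ee τ) * qPochInf ((ee z)⁻¹ * ee τ) (ee τ)

/-- universal mock theta function g₂ -/
def g2 (ζ q : ℂ) : ℂ :=
  ∑' n : ℕ, qPoch (-q) q n * q ^ (n * (n + 1) / 2) /
    (qPoch ζ q (n + 1) * qPoch (ζ⁻¹ * q) q (n + 1))

/-- universal mock theta function g₃ -/
def g3 (ζ q : ℂ) : ℂ :=
  ∑' n : ℕ, q ^ (n * (n + 1)) / (qPoch ζ q (n + 1) * qPoch (ζ⁻¹ * q) q (n + 1))

/-- the series L -/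
def Lser (ζ q : ℂ) : ℂ :=
  (1 / 2) * ∑' n : ℕ, q ^ n * qPoch (ζ⁻¹ * q) q n * qPoch ζ q n / qPoch (-q) q n

/-- the function M -/
def Mfun (z τ : ℂ) : ℂ :=
  -(Complex.I / 2) * Complex.exp (Real.pi * Complex.I * z) * theta z τ *
    g3 (-(ee z)) (ee τ) / (Complex.exp (Real.pi * Complex.I * τ / 12) * eta (2 * τ))

/-- the function T -/
def Tfun (z τ : ℂ) : ℂ :=
  -Complex.I * eta (2 * τ) ^ 4 / (ee z * eta τ ^ 2 * theta (2 * z) (2 * τ))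
  - Complex.I * eta (2 * τ) ^ 10 * theta (2 * z + 1 / 2) (2 * τ) /
      (2 * ee z ^ 2 * Complex.exp (Real.pi * Complex.I * τ / 2) * eta τ ^ 4 * eta (4 * τ) ^ 4 *
        theta (2 * z) (2 * τ) * theta (2 * z + τ + 1 / 2) (2 * τ))
  - Complex.I * eta (2 * τ) ^ 4 * theta z τ /
      (2 * Complex.exp (Real.pi * Complex.I * τ / 2) * ee z ^ 2 * eta (4 * τ) ^ 2 *
        theta (z + 1 / 2) τ * theta (2 * z + τ + 1 / 2) (2 * τ))

/-- the function K -/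
def Kfun (z τ : ℂ) : ℂ :=
  eta (2 * τ) ^ 4 / (Complex.I * ee z * eta τ ^ 2 * theta (2 * z) (2 * τ))

/-- Zwegers' μ-function -/
def mu (z₁ z₂ τ : ℂ) : ℂ :=
  Complex.exp (Real.pi * Complex.I * z₁) / theta z₂ τ *
    ∑' n : ℤ, (-(ee z₂)) ^ n * Complex.exp (Real.pi * Complex.I * (n : ℂ) * ((n : ℂ) + 1) * τ) /
      (1 - ee z₁ * (ee τ) ^ n)

/-- the Appell–Lerch sum A -/
def appell (ζ q : ℂ) : ℂ :=
  ∑' n : ℤ, (-1 : ℂ) ^ n * q ^ ((3 * n * (n + 1)) / 2) / (1 + ζ * q ^ n)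

/-- the function Θ -/
def bigTheta (z₁ z₂ z τ : ℂ) : ℂ :=
  (1 / (2 * Real.pi * Complex.I)) * deriv (fun w => theta w τ) 0 *
    theta (z₁ + z₂ + z) τ * theta z τ /
    (theta z₁ τ * theta z₂ τ * theta (z₁ + z) τ * theta (z₂ + z) τ)

/-- the function 𝔱 -/
def tfrak (z τ : ℂ) : ℂ :=
  Kfun z τ - Complex.I * Kfun (z + 1 / 4) (τ + 1 / 2) +
    Complex.I * Complex.exp (-(Real.pi * Complex.I * τ / 2)) * bigTheta (2 * z) τ (1 / 2) (2 * τ)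

/-- the second order mock theta function B -/
def mockB (q : ℂ) : ℂ :=
  ∑' n : ℕ, q ^ n * qPoch (-q) (q ^ 2) n / qPoch q (q ^ 2) (n + 1)

/-- Ramanujan's third order mock theta function f -/
def mockf (q : ℂ) : ℂ := ∑' n : ℕ, q ^ (n ^ 2) / qPoch (-q) q n ^ 2

/-- the modular form b -/
def bfun (q : ℂ) : ℂ := qPochInf q q / qPochInf (-q) q ^ 2

/-- τ(t) = h/k + it/(2π) -/
def tauT (h k : ℕ) (t : ℝ) : ℂ := (h : ℂ) / (k : ℂ) + Complex.I * (t : ℂ) / (2 * Real.pi)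

/-- q(t) = e^{2πiτ(t)} -/
def qT (h k : ℕ) (t : ℝ) : ℂ := ee (tauT h k t)

section QPochhammer

variable {x q : ℂ}

lemma summable_norm_neg_mul_pow (x : ℂ) (hq : ‖q‖ < 1) :
    Summable fun j : ℕ ↦ ‖-(x * q ^ j)‖ := by
  simpa [norm_mul, norm_pow] using
    (summable_geometric_of_lt_one (norm_nonneg q) hq).mul_left ‖x‖

lemma multipliable_one_sub_mul_pow (x : ℂ) (hq : ‖q‖ < 1) :
    Multipliable fun j : ℕ ↦ 1 - x * q ^ j := by
  simpa [sub_eq_add_neg] using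
    multipliable_one_add_of_summable (summable_norm_neg_mul_pow x hq)

lemma norm_sq_lt_one (hq : ‖q‖ < 1) : ‖q ^ 2‖ < 1 := by
  rw [norm_pow]
  exact pow_lt_one₀ (norm_nonneg q) hq two_ne_zero

lemma qPochInf_ne_zero (hx : ‖x‖ < 1) (hq : ‖q‖ < 1) : qPochInf x q ≠ 0 := by
  have h := tprod_one_add_ne_zero_of_summable (f := fun j : ℕ ↦ -(x * q ^ j)) ?_
    (summable_norm_neg_mul_pow x hq)
  · simpa [qPochInf, sub_eq_add_neg] using h
  · intro j h
    have h1 : x * q ^ j = 1 := by linear_combination -h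
    have h2 : ‖x * q ^ j‖ < 1 := by
      rw [norm_mul, norm_pow]
      exact mul_lt_one_of_nonneg_of_lt_one_left (norm_nonneg x) hx
        (pow_le_one₀ (norm_nonneg q) hq.le)
    rw [h1, norm_one] at h2
    exact lt_irrefl _ h2

/-- Splitting the product into even and odd indices. -/
lemma qPochInf_sq_mul_qPochInf_mul_sq (x : ℂ) (hq : ‖q‖ < 1) :
    qPochInf x (q ^ 2) * qPochInf (x * q) (q ^ 2) = qPochInf x q := by
  have hq2 := norm_sq_lt_one hq
  have h := tprod_even_mul_odd (f := fun j : ℕ ↦ 1 - x * q ^ j)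
    (by simpa only [pow_mul] using multipliable_one_sub_mul_pow x hq2)
    (by simpa only [pow_succ', pow_mul, mul_assoc] using
      multipliable_one_sub_mul_pow (x * q) hq2)
  simpa only [qPochInf, pow_succ', pow_mul, mul_assoc] using h

lemma qPochInf_mul_qPochInf_neg (x : ℂ) (hq : ‖q‖ < 1) :
    qPochInf x q * qPochInf (-x) q = qPochInf (x ^ 2) (q ^ 2) := by
  unfold qPochInf
  rw [← (multipliable_one_sub_mul_pow x hq).tprod_mul (multipliable_one_sub_mul_pow (-x) hq)]
  exact tprod_congr fun j ↦ by ring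

lemma qPochInf_eq_one_sub_mul (x : ℂ) (hq : ‖q‖ < 1) :
    qPochInf x q = (1 - x) * qPochInf (x * q) q := by
  unfold qPochInf
  rw [tprod_eq_zero_mul']
  · simp [pow_succ', mul_assoc]
  · simpa only [pow_succ', mul_assoc] using multipliable_one_sub_mul_pow (x * q) hq

/-- The odd part of the Euler product. -/
lemma qPochInf_self_sq (hq : ‖q‖ < 1) :
    qPochInf q (q ^ 2) = qPochInf q q / qPochInf (q ^ 2) (q ^ 2) := by
  rw [eq_div_iff (qPochInf_ne_zero (norm_sq_lt_one hq) (norm_sq_lt_one hq)),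
    ← qPochInf_sq_mul_qPochInf_mul_sq q hq, sq]

lemma qPochInf_neg_self (hq : ‖q‖ < 1) :
    qPochInf (-q) q = qPochInf (q ^ 2) (q ^ 2) / qPochInf q q := by
  rw [eq_div_iff (qPochInf_ne_zero hq hq), mul_comm, qPochInf_mul_qPochInf_neg q hq]

lemma qPochInf_neg_one (hq : ‖q‖ < 1) :
    qPochInf (-1) q = 2 * (qPochInf (q ^ 2) (q ^ 2) / qPochInf q q) := by
  rw [qPochInf_eq_one_sub_mul (-1) hq, neg_one_mul, qPochInf_neg_self hq]
  ring

lemma qPochInf_neg_self_sq (hq : ‖q‖ < 1) :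
    qPochInf (-q) (q ^ 2) = qPochInf (q ^ 2) (q ^ 2) ^ 2 /
      (qPochInf (q ^ 4) (q ^ 4) * qPochInf q q) := by
  have hq2 := norm_sq_lt_one hq
  have hq4 := norm_sq_lt_one hq2
  have h1 := qPochInf_ne_zero hq hq
  have h2 := qPochInf_ne_zero hq2 hq2
  have h4 := qPochInf_ne_zero hq4 hq4
  have h := qPochInf_mul_qPochInf_neg q hq2
  rw [qPochInf_self_sq hq2, qPochInf_self_sq hq] at h
  rw [← pow_mul] at h h4
  norm_num at h h4
  field_simp at h ⊢
  linear_combination h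

end QPochhammer

lemma ee_nat_mul (n : ℕ) (z : ℂ) : ee (n * z) = ee z ^ n := by
  rw [ee, ee, ← Complex.exp_nat_mul]
  ring_nf

lemma ee_add_half (z : ℂ) : ee (z + 1 / 2) = -ee z := by
  rw [ee, ee, mul_add, Complex.exp_add,
    show (2 * Real.pi * Complex.I * (1 / 2) : ℂ) = Real.pi * Complex.I by ring,
    Complex.exp_pi_mul_I, mul_neg_one]

lemma exp_pi_mul_I_mul_div (n : ℕ) {τ w : ℂ} (h : w = n * (Real.pi * Complex.I * τ / 12)) :
    Complex.exp w = Complex.exp (Real.pi * Complex.I * τ / 12) ^ n := by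
  rw [h, Complex.exp_nat_mul]

lemma exp_neg_pi_mul_I_add_half (z : ℂ) :
    Complex.exp (-(Real.pi * Complex.I * (z + 1 / 2))) =
      -Complex.I * Complex.exp (-(Real.pi * Complex.I * z)) := by
  rw [show -(Real.pi * Complex.I * (z + 1 / 2)) =
    -(Real.pi / 2 * Complex.I) + -(Real.pi * Complex.I * z) by ring, Complex.exp_add,
    Complex.exp_neg (Real.pi / 2 * Complex.I), Complex.exp_pi_div_two_mul_I, Complex.inv_I]

section ThetaValues

variable {τ : ℂ}

lemma norm_ee_lt_one (hτ : 0 < τ.im) : ‖ee τ‖ < 1 :=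
  UpperHalfPlane.norm_exp_two_pi_I_lt_one ⟨τ, hτ⟩

lemma eta_ne_zero (hτ : 0 < τ.im) : eta τ ≠ 0 :=
  mul_ne_zero (Complex.exp_ne_zero _) (qPochInf_ne_zero (norm_ee_lt_one hτ) (norm_ee_lt_one hτ))

lemma ee_two_mul (z : ℂ) : ee (2 * z) = ee z ^ 2 := mod_cast ee_nat_mul 2 z

/-- The value of theta at the half period `τ` of the lattice `ℤ + 2τℤ`. -/
lemma theta_half_period (hτ : 0 < τ.im) :
    theta τ (2 * τ) = -Complex.I * Complex.exp (-(Real.pi * Complex.I * τ / 2)) *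
      (qPochInf (ee τ) (ee τ) ^ 2 / qPochInf (ee τ ^ 2) (ee τ ^ 2)) := by
  have hq := norm_ee_lt_one hτ
  have h0 : ee τ ≠ 0 := Complex.exp_ne_zero _
  have hE := qPochInf_ne_zero (norm_sq_lt_one hq) (norm_sq_lt_one hq)
  have he : Complex.exp (-(Real.pi * Complex.I * τ / 2)) =
      Complex.exp (Real.pi * Complex.I * (2 * τ) / 4) *
        Complex.exp (-(Real.pi * Complex.I * τ)) := by
    rw [← Complex.exp_add]; ring_nf
  rw [theta, ee_two_mul, show (ee τ)⁻¹ * ee τ ^ 2 = ee τ by field_simp, qPochInf_self_sq hq, he]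
  field_simp

/-- The value of theta at `τ + 1/2` for the lattice `ℤ + 2τℤ`. -/
lemma theta_half_period_add_half (hτ : 0 < τ.im) :
    theta (τ + 1 / 2) (2 * τ) = -Complex.exp (-(Real.pi * Complex.I * τ / 2)) *
      (qPochInf (ee τ ^ 2) (ee τ ^ 2) ^ 5 /
        (qPochInf (ee τ ^ 4) (ee τ ^ 4) * qPochInf (ee τ) (ee τ)) ^ 2) := by
  have hq := norm_ee_lt_one hτ
  have h0 : ee τ ≠ 0 := Complex.exp_ne_zero _
  have he : Complex.exp (-(Real.pi * Complex.I * τ / 2)) =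
      Complex.exp (Real.pi * Complex.I * (2 * τ) / 4) *
        Complex.exp (-(Real.pi * Complex.I * τ)) := by
    rw [← Complex.exp_add]; ring_nf
  rw [theta, ee_two_mul, ee_add_half, show (-ee τ)⁻¹ * ee τ ^ 2 = -ee τ by field_simp,
    qPochInf_neg_self_sq hq, exp_neg_pi_mul_I_add_half, he]
  ring_nf
  rw [Complex.I_sq]
  ring

/-- The value of theta at `τ + 1/2` for the lattice `ℤ + τℤ`. -/
lemma theta_period_add_half (hτ : 0 < τ.im) :
    theta (τ + 1 / 2) τ = -2 * Complex.exp (-(3 * (Real.pi * Complex.I * τ / 4))) *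
      (qPochInf (ee τ ^ 2) (ee τ ^ 2) ^ 2 / qPochInf (ee τ) (ee τ)) := by
  have hq := norm_ee_lt_one hτ
  have h0 : ee τ ≠ 0 := Complex.exp_ne_zero _
  have hE := qPochInf_ne_zero hq hq
  have he : Complex.exp (-(3 * (Real.pi * Complex.I * τ / 4))) =
      Complex.exp (Real.pi * Complex.I * τ / 4) * Complex.exp (-(Real.pi * Complex.I * τ)) := by
    rw [← Complex.exp_add]; ring_nf
  rw [theta, ee_add_half, show (-ee τ)⁻¹ * ee τ = -1 by field_simp,
    qPochInf_neg_self hq, qPochInf_neg_one hq, exp_neg_pi_mul_I_add_half, he]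
  field_simp
  rw [Complex.I_sq]
  ring

end ThetaValues

/-- The eta-quotient evaluation of T(τ;2τ). -/
theorem statement19 (τ : ℂ) (hτ : 0 < τ.im) :
    (eta (2 * τ) ≠ 0 ∧ eta (8 * τ) ≠ 0 ∧ theta (2 * τ) (4 * τ) ≠ 0 ∧
      theta (4 * τ + 1 / 2) (4 * τ) ≠ 0 ∧ theta (τ + 1 / 2) (2 * τ) ≠ 0) ∧
    Tfun τ (2 * τ) =
      Complex.exp (-(Real.pi * Complex.I * τ)) *
        (eta (4 * τ) ^ 5 / eta (2 * τ) ^ 4 +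
          eta (4 * τ) ^ 17 / (4 * eta (2 * τ) ^ 8 * eta (8 * τ) ^ 8) -
          eta (4 * τ) ^ 7 * eta τ ^ 4 / (4 * eta (2 * τ) ^ 6 * eta (8 * τ) ^ 4)) := by
  have hτ2 : 0 < (2 * τ).im := by simpa using hτ
  have hτ4 : 0 < (4 * τ).im := by simpa using hτ
  have hτ8 : 0 < (8 * τ).im := by simpa using hτ
  have hA := theta_half_period hτ
  have hB := theta_half_period_add_half hτ
  have hC := theta_half_period hτ2
  have hD := theta_half_period_add_half hτ2
  have hF := theta_period_add_half hτ4
  have e2 : ee (2 * τ) = ee τ ^ 2 := ee_two_mul τ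
  have e4 : ee (4 * τ) = ee τ ^ 4 := mod_cast ee_nat_mul 4 τ
  have e8 : ee (8 * τ) = ee τ ^ 8 := mod_cast ee_nat_mul 8 τ
  have h22 : 2 * (2 * τ) = 4 * τ := by ring
  have h42 : 4 * (2 * τ) = 8 * τ := by ring
  have hE1 := qPochInf_ne_zero (norm_ee_lt_one hτ) (norm_ee_lt_one hτ)
  have hE2 := qPochInf_ne_zero (norm_ee_lt_one hτ2) (norm_ee_lt_one hτ2)
  have hE4 := qPochInf_ne_zero (norm_ee_lt_one hτ4) (norm_ee_lt_one hτ4)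
  have hE8 := qPochInf_ne_zero (norm_ee_lt_one hτ8) (norm_ee_lt_one hτ8)
  rw [h22] at hC hD
  simp only [e2, e4, e8, ← pow_mul, Nat.reduceMul] at hC hD hF hE2 hE4 hE8
  constructor
  · refine ⟨eta_ne_zero hτ2, eta_ne_zero hτ8, ?_, ?_, ?_⟩
    · rw [hC]; simp [hE2, hE4, Complex.exp_ne_zero]
    · rw [hF]; simp [hE4, hE8, Complex.exp_ne_zero]
    · rw [hB]; simp [hE1, hE2, hE4, Complex.exp_ne_zero]
  rw [Tfun, h22, h42, show 2 * τ + 2 * τ + 1 / 2 = 4 * τ + 1 / 2 by ring, hA, hB, hC, hD, hF]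
  simp only [eta, e2, e4, e8]
  have hr : Complex.exp (Real.pi * Complex.I * τ / 12) ≠ 0 := Complex.exp_ne_zero _
  have hq : ee τ = Complex.exp (Real.pi * Complex.I * τ / 12) ^ 24 :=
    exp_pi_mul_I_mul_div 24 (by push_cast; ring)
  generalize qPochInf (ee τ) (ee τ) = E1 at *
  generalize qPochInf (ee τ ^ 2) (ee τ ^ 2) = E2 at *
  generalize qPochInf (ee τ ^ 4) (ee τ ^ 4) = E4 at *
  generalize qPochInf (ee τ ^ 8) (ee τ ^ 8) = E8 at *
  clear hA hB hC hD hF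
  rw [hq]
  simp only [Complex.exp_neg]
  rw [exp_pi_mul_I_mul_div 2 (τ := τ) (w := Real.pi * Complex.I * (2 * τ) / 12)
      (by push_cast; ring),
    exp_pi_mul_I_mul_div 4 (τ := τ) (w := Real.pi * Complex.I * (4 * τ) / 12)
      (by push_cast; ring),
    exp_pi_mul_I_mul_div 8 (τ := τ) (w := Real.pi * Complex.I * (8 * τ) / 12)
      (by push_cast; ring),
    exp_pi_mul_I_mul_div 12 (τ := τ) (w := Real.pi * Complex.I * (2 * τ) / 2)
      (by push_cast; ring),
    exp_pi_mul_I_mul_div 12 (τ := τ) (w := Real.pi * Complex.I * τ) (by push_cast; ring),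
    exp_pi_mul_I_mul_div 36 (τ := τ) (w := 3 * (Real.pi * Complex.I * (4 * τ) / 4))
      (by push_cast; ring),
    exp_pi_mul_I_mul_div 6 (τ := τ) (w := Real.pi * Complex.I * τ / 2) (by push_cast; ring)]
  generalize Complex.exp (Real.pi * Complex.I * τ / 12) = r at *
  have hI := Complex.I_ne_zero
  field_simp
  linear_combination 4 * E1 ^ 4 * E2 ^ 2 * E4 ^ 2 * E8 ^ 4 * Complex.I_sq

end
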